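/- Let p ∈ (1,∞] and let X denote either W^{1,p} or C^{0,1−1/p}. Suppose that every x₀ ∈ C^{0,1−1/p} admits a solution of ẋ(t) = f(x_t) on [0,∞) (write φ(t,x₀) := x_t). Then there exists σ ∈ KL with ‖φ(t,x₀)‖_X ≤ σ(‖x₀‖_X, t) for all t ≥ 0 and x₀ ∈ X if and only if there exist a functional V : X → [0,∞) that is Lipschitz on bounded subsets of (X, ‖·‖_X) and functions a₁, a₂ of class K∞ such that, for all x ∈ X: a₁(‖x‖_X) ≤ V(x) ≤ a₂(‖x‖_X) and V(φ(t,x)) ≤ exp(−t) V(x) for all t ≥ 0. -/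

import Mathlib

open Set MeasureTheory Filter Topology
open scoped ENNReal NNReal

noncomputable section

abbrev Vec (n : ℕ) := EuclideanSpace ℝ (Fin n)

variable {n : ℕ}

/-- The segment `x_t` of a history `x : ℝ → ℝⁿ`, i.e. `x_t(s) = x(t+s)`
(only its values on `[-r,0]` are relevant). -/
def seg (r : ℝ) (x : ℝ → Vec n) (t : ℝ) : ℝ → Vec n := fun s => x (t + s)

/-- Sup norm over `[-r,0]`. -/
def supN (r : ℝ) (g : ℝ → Vec n) : ℝ := sSup ((fun s => ‖g s‖) '' Icc (-r) 0)

/-- Membership in `C⁰ = C([-r,0];ℝⁿ)`. -/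
def MemC0 (r : ℝ) (g : ℝ → Vec n) : Prop := ContinuousOn g (Icc (-r) 0)

/-- `f` vanishes at `0`, depends only on the values of its argument on `[-r,0]`,
and is Lipschitz on bounded subsets of `C⁰` with a nondecreasing (nonnegative)
modulus `L`. -/
def GoodRHS (r : ℝ) (f : (ℝ → Vec n) → Vec n) (L : ℝ → ℝ) : Prop :=
  f 0 = 0 ∧
  (∀ x y : ℝ → Vec n, EqOn x y (Icc (-r) 0) → f x = f y) ∧
  Monotone L ∧ (∀ s : ℝ, 0 ≤ L s) ∧
  ∀ R : ℝ, ∀ x y : ℝ → Vec n, MemC0 r x → MemC0 r y → supN r x ≤ R → supN r y ≤ R →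
    ‖f x - f y‖ ≤ L R * supN r (x - y)

/-- `x : ℝ → ℝⁿ` is a solution on `[-r, b)` (with `b ∈ (0,∞]` an extended
nonnegative real) of the delay system `ẋ(t) = f(x_t)` with initial condition `x0`:
it is continuous on `[-r,b)`, coincides with `x0` on `[-r,0]`, and satisfies the
integral equation `x(t) = x(0) + ∫₀ᵗ f(x_s) ds` on `[0,b)`. -/
def IsSol (r : ℝ) (f : (ℝ → Vec n) → Vec n) (x0 x : ℝ → Vec n) (b : ℝ≥0∞) : Prop :=
  ContinuousOn x {t : ℝ | -r ≤ t ∧ ENNReal.ofReal t < b} ∧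
  EqOn x x0 (Icc (-r) 0) ∧
  ∀ t : ℝ, 0 ≤ t → ENNReal.ofReal t < b → x t = x 0 + ∫ s in (0:ℝ)..t, f (seg r x s)

/-- Class `KL` functions `σ : [0,∞)×[0,∞) → [0,∞)`. -/
def ClassKL (σ : ℝ → ℝ → ℝ) : Prop :=
  (∀ s t : ℝ, 0 ≤ s → 0 ≤ t → 0 ≤ σ s t) ∧
  (∀ t : ℝ, 0 ≤ t →
    ContinuousOn (fun s => σ s t) (Ici 0) ∧ StrictMonoOn (fun s => σ s t) (Ici 0) ∧
      σ 0 t = 0) ∧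
  (∀ s : ℝ, 0 ≤ s →
    AntitoneOn (fun t => σ s t) (Ici 0) ∧ Tendsto (fun t => σ s t) atTop (nhds 0))

/-- Class `K∞` functions `a : [0,∞) → [0,∞)`. -/
def ClassKInf (a : ℝ → ℝ) : Prop :=
  (∀ s : ℝ, 0 ≤ s → 0 ≤ a s) ∧ ContinuousOn a (Ici 0) ∧ StrictMonoOn a (Ici 0) ∧
  a 0 = 0 ∧ Tendsto a atTop atTop

/-- The set of Hölder difference quotients `‖g t - g s‖ / |t-s|^α` over a set `S`. -/
def hRatios (α : ℝ) (S : Set ℝ) (g : ℝ → Vec n) : Set ℝ :=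
  {c | ∃ t ∈ S, ∃ s ∈ S, t ≠ s ∧ c = ‖g t - g s‖ / |t - s| ^ α}

/-- Membership in the Hölder space `C^{0,α}([-r,0])`. -/
def MemHol (r α : ℝ) (g : ℝ → Vec n) : Prop :=
  MemC0 r g ∧ BddAbove (hRatios α (Icc (-r) 0) g)

/-- The Hölder norm `max(‖g‖_∞, [g]_α)`. -/
def holderNorm (r α : ℝ) (g : ℝ → Vec n) : ℝ :=
  max (supN r g) (sSup (hRatios α (Icc (-r) 0) g))

/-- Membership in the Sobolev space `W^{1,p}([-r,0])`: `g` is absolutely continuous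
on `[-r,0]` (i.e. the integral of an integrable function `d`, which is then its a.e.
derivative) with `d ∈ L^p((-r,0))`. -/
def MemW (r : ℝ) (p : ℝ≥0∞) (g : ℝ → Vec n) : Prop :=
  ∃ d : ℝ → Vec n, IntegrableOn d (Icc (-r) 0) ∧
    eLpNorm d p (volume.restrict (Ioo (-r) 0)) < ⊤ ∧
    ∀ t ∈ Icc (-r) 0, g t = g (-r) + ∫ s in (-r)..t, d s

/-- The Sobolev norm `‖g‖_∞ + ‖ġ‖_p`; for an absolutely continuous `g` the a.e.
derivative coincides a.e. on `(-r,0)` with `deriv g`. -/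
def sobNorm (r : ℝ) (p : ℝ≥0∞) (g : ℝ → Vec n) : ℝ :=
  supN r g + (eLpNorm (deriv g) p (volume.restrict (Ioo (-r) 0))).toReal

/-- The Hölder exponent `1 - 1/p`, with the convention `1/∞ = 0`. -/
def hexp (p : ℝ≥0∞) : ℝ := 1 - (p.toReal)⁻¹


/-! ### Comparison functions -/

theorem kinf_inverse (a : ℝ → ℝ) (ha : ClassKInf a) :
    ∃ b : ℝ → ℝ, ClassKInf b ∧ ∀ s u : ℝ, 0 ≤ s → 0 ≤ u → a s ≤ u → s ≤ b u := by
  obtain ⟨h0, hc, hm, hz, ht⟩ := ha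
  have hsurj : ∀ u : ℝ, 0 ≤ u → ∃ s : ℝ, 0 ≤ s ∧ a s = u := by
    intro u hu
    obtain ⟨M, hM1, hM0⟩ := ((ht.eventually_ge_atTop u).and (eventually_ge_atTop 0)).exists
    have := intermediate_value_Icc hM0 (hc.mono (Icc_subset_Ici_self))
    obtain ⟨s, hs, hsu⟩ := this ⟨by rw [hz]; exact hu, hM1⟩
    exact ⟨s, hs.1, hsu⟩
  choose! b hb0 hb using hsurj
  have hmono : StrictMonoOn b (Ici 0) := by
    intro u hu v hv huv
    by_contra hcon
    push Not at hcon
    have := hm.monotoneOn (hb0 v hv) (hb0 u hu) hcon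
    rw [hb u hu, hb v hv] at this
    linarith
  have hba : ∀ s : ℝ, 0 ≤ s → b (a s) = s := fun s hs =>
    hm.injOn (hb0 _ (h0 s hs)) hs (hb _ (h0 s hs))
  refine ⟨b, ⟨hb0, ?_, hmono, ?_, ?_⟩, ?_⟩
  · have himg : b '' Ici 0 = Ici 0 := by
      ext s
      constructor
      · rintro ⟨u, hu, rfl⟩
        exact hb0 u hu
      · intro hs
        exact ⟨a s, h0 s hs, hba s hs⟩
    have : Continuous (fun u : Ici (0:ℝ) => (⟨b u, hb0 u u.2⟩ : Ici (0:ℝ))) := by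
      apply Monotone.continuous_of_surjective
      · intro u v huv
        exact hmono.monotoneOn u.2 v.2 huv
      · intro s
        exact ⟨⟨a s, h0 s s.2⟩, Subtype.ext (hba s s.2)⟩
    rw [continuousOn_iff_continuous_domRestrict]
    exact continuous_subtype_val.comp this
  · have := hba 0 le_rfl
    rwa [hz] at this
  · refine tendsto_atTop.2 fun M => ?_
    filter_upwards [eventually_ge_atTop (a (max M 0))] with u hu
    have hA := h0 (max M 0) (le_max_right _ _)
    calc M ≤ max M 0 := le_max_left _ _
      _ = b (a (max M 0)) := (hba _ (le_max_right _ _)).symm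
      _ ≤ b u := hmono.monotoneOn hA (hA.trans hu) hu
  · intro s u hs hu hsu
    rw [← hba s hs]
    exact hmono.monotoneOn (h0 s hs) hu hsu

theorem kl_of_kinf (b a : ℝ → ℝ) (hb : ClassKInf b) (ha : ClassKInf a) :
    ClassKL (fun s t => b (Real.exp (-t) * a s)) := by
  obtain ⟨b0, bc, bm, bz, bt⟩ := hb
  obtain ⟨a0, ac, am, az, -⟩ := ha
  have hE : ∀ t : ℝ, 0 < Real.exp (-t) := fun t => Real.exp_pos _
  have hn : ∀ s t : ℝ, 0 ≤ s → 0 ≤ Real.exp (-t) * a s :=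
    fun s t hs => mul_nonneg (hE t).le (a0 s hs)
  refine ⟨fun s t hs _ => b0 _ (hn s t hs), fun t _ => ⟨?_, ?_, ?_⟩, fun s hs => ⟨?_, ?_⟩⟩
  · exact bc.comp (continuousOn_const.mul ac) (fun s hs => hn s t hs)
  · intro s hs u hu hsu
    exact bm (hn s t hs) (hn u t hu) (mul_lt_mul_of_pos_left (am hs hu hsu) (hE t))
  · simp [az, bz]
  · intro t _ u _ htu
    apply bm.monotoneOn (hn s u hs) (hn s t hs)
    exact mul_le_mul_of_nonneg_right (Real.exp_le_exp.2 (by linarith)) (a0 s hs)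
  · have h1 : Tendsto (fun t : ℝ => Real.exp (-t) * a s) atTop (𝓝 0) := by
      simpa using (Real.tendsto_exp_neg_atTop_nhds_zero).mul_const (a s)
    have h2 : Tendsto (fun t : ℝ => Real.exp (-t) * a s) atTop (𝓝[Ici 0] 0) :=
      tendsto_nhdsWithin_iff.2 ⟨h1, Eventually.of_forall fun t => hn s t hs⟩
    have h3 : Tendsto b (𝓝[Ici 0] 0) (𝓝 (b 0)) := bc 0 (by simp)
    rw [bz] at h3
    exact h3.comp h2

/-- A K-infinity majorant of `K_k s` for `s ≤ k`. -/
theorem kinf_majorant (K : ℕ → ℝ) :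
    ∃ a : ℝ → ℝ, ClassKInf a ∧ ∀ s : ℝ, 0 ≤ s → ∃ k : ℕ, s ≤ k ∧ K k * s ≤ a s := by
  obtain ⟨g, hg0, hgm, hgK⟩ : ∃ g : ℝ → ℝ, (∀ s, 0 ≤ g s) ∧ Monotone g ∧
      ∀ s : ℝ, K ⌈s⌉₊ ≤ g s := by
    refine ⟨fun s => ∑ k ∈ Finset.range (⌈s⌉₊ + 1), |K k|,
      fun s => Finset.sum_nonneg fun _ _ => abs_nonneg _, ?_, ?_⟩
    · intro s u hsu
      apply Finset.sum_le_sum_of_subset_of_nonneg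
      · apply Finset.range_mono
        have := Nat.ceil_mono hsu
        omega
      · intros
        exact abs_nonneg _
    · intro s
      refine (le_abs_self _).trans ?_
      exact Finset.single_le_sum (f := fun k => |K k|) (fun _ _ => abs_nonneg _)
        (Finset.mem_range.2 (Nat.lt_succ_self _))
  have hIntg : ∀ a b : ℝ, IntervalIntegrable g volume a b := fun a b => hgm.intervalIntegrable
  set G : ℝ → ℝ := fun s => ∫ u in s..(s+1), g u with hG
  have hGe : ∀ s, G s = ∫ u in (0:ℝ)..1, g (s + u) := by
    intro s
    rw [intervalIntegral.integral_comp_add_left]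
    simp [hG]
  have hGm : Monotone G := by
    intro s t hst
    rw [hGe, hGe]
    apply intervalIntegral.integral_mono_on zero_le_one
    · exact Monotone.intervalIntegrable (fun a b hab => hgm (by linarith))
    · exact Monotone.intervalIntegrable (fun a b hab => hgm (by linarith))
    · intro u _
      exact hgm (by linarith)
  have hGc : Continuous G := by
    have hp : Continuous (fun s => ∫ u in (0:ℝ)..s, g u) :=
      intervalIntegral.continuous_primitive hIntg 0
    have : G = fun s => (∫ u in (0:ℝ)..(s+1), g u) - ∫ u in (0:ℝ)..s, g u := by
      funext s
      rw [intervalIntegral.integral_interval_sub_left (hIntg _ _) (hIntg _ _)]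
    rw [this]
    exact (hp.comp (continuous_id.add continuous_const)).sub hp
  have hGg : ∀ s, g s ≤ G s := by
    intro s
    have : ∫ u in s..(s+1), g s ≤ ∫ u in s..(s+1), g u := by
      apply intervalIntegral.integral_mono_on (by linarith) (by simp) (hIntg _ _)
      intro u hu
      exact hgm hu.1
    simpa using this
  have hG0 : ∀ s, 0 ≤ G s := fun s => (hg0 s).trans (hGg s)
  refine ⟨fun s => (1 + G s) * s, ⟨?_, ?_, ?_, by simp, ?_⟩, ?_⟩
  · intro s hs
    have := hG0 s
    positivity
  · fun_prop
  · intro s hs t ht hst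
    have h1 := hGm hst.le
    have h2 := hG0 s
    have h3 : (0:ℝ) ≤ s := hs
    simp only
    nlinarith
  · refine tendsto_atTop_mono' _ ?_ tendsto_id
    filter_upwards [eventually_ge_atTop 0] with s hs
    have := hG0 s
    simp only [id]
    nlinarith
  · intro s hs
    refine ⟨⌈s⌉₊, Nat.le_ceil s, ?_⟩
    apply mul_le_mul_of_nonneg_right _ hs
    have := hgK s
    have := hGg s
    linarith

/-! ### The abstract converse Lyapunov construction -/

/-- Level functional. -/
def Ufun {E : Type*} (ν : E → ℝ → ℝ) (q : ℕ) (x : E) : ℝ :=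
  ⨆ t : ℝ≥0, Real.exp t * max 0 (ν x t - 1 / ((q:ℝ) + 1))

theorem Ufun_props {E : Type*} (Mem : E → Prop) (N : E → ℝ) (δ : E → E → ℝ) (ν : E → ℝ → ℝ)
    (σ : ℝ → ℝ → ℝ) (hσ : ClassKL σ)
    (hN : ∀ x, Mem x → 0 ≤ N x) (hδ : ∀ x y, Mem x → Mem y → 0 ≤ δ x y)
    (hν : ∀ x, Mem x → ∀ t : ℝ, 0 ≤ t → ν x t ≤ σ (N x) t)
    (hLip : ∀ R T : ℝ, ∃ M : ℝ, 0 ≤ M ∧ ∀ x y, Mem x → Mem y → N x ≤ R → N y ≤ R →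
      ∀ t : ℝ, 0 ≤ t → t ≤ T → |ν x t - ν y t| ≤ M * δ x y) (q k : ℕ) :
    (∀ x, Mem x → N x ≤ k →
      BddAbove (range fun t : ℝ≥0 => Real.exp t * max 0 (ν x t - 1 / ((q:ℝ) + 1)))) ∧
    ∃ C : ℝ, 0 ≤ C ∧ ∀ x y, Mem x → Mem y → N x ≤ k → N y ≤ k →
      |Ufun ν q x - Ufun ν q y| ≤ C * δ x y := by
  obtain ⟨s0, s1, s2⟩ := hσ
  have hk : (0:ℝ) ≤ k := Nat.cast_nonneg k
  have hq : (0:ℝ) < 1 / ((q:ℝ) + 1) := by positivity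
  obtain ⟨T, hT1, hT0⟩ := (((s2 k hk).2.eventually_lt_const hq).and (eventually_ge_atTop 0)).exists
  have hbd : ∀ x, Mem x → N x ≤ k → ∀ t : ℝ, 0 ≤ t → ν x t ≤ σ k t := fun x hx hxk t ht =>
    (hν x hx t ht).trans ((s1 t ht).2.1.monotoneOn (hN x hx) hk hxk)
  have hvan : ∀ x, Mem x → N x ≤ k → ∀ t : ℝ, T ≤ t → max 0 (ν x t - 1 / ((q:ℝ) + 1)) = 0 := by
    intro x hx hxk t ht
    apply max_eq_left
    have h1 := hbd x hx hxk t (hT0.trans ht)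
    have h2 : σ k t ≤ σ k T := (s2 k hk).1 hT0 (hT0.trans ht) ht
    linarith
  have hB : ∀ x, Mem x → N x ≤ k →
      BddAbove (range fun t : ℝ≥0 => Real.exp t * max 0 (ν x t - 1 / ((q:ℝ) + 1))) := by
    intro x hx hxk
    refine ⟨Real.exp T * σ k 0, ?_⟩
    rintro _ ⟨t, rfl⟩
    have hs0 := s0 k 0 hk le_rfl
    by_cases htT : T ≤ t
    · simp only
      rw [hvan x hx hxk t htT, mul_zero]
      positivity
    · push Not at htT
      simp only
      apply mul_le_mul (Real.exp_le_exp.2 htT.le) _ (le_max_left _ _) (Real.exp_pos _).le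
      have h1 := hbd x hx hxk t t.2
      have h2 : σ k t ≤ σ k 0 := (s2 k hk).1 (by simp) t.2 t.2
      apply max_le hs0
      linarith
  obtain ⟨M, hM0, hM⟩ := hLip k T
  refine ⟨hB, Real.exp T * M, by positivity, ?_⟩
  have key : ∀ x y, Mem x → Mem y → N x ≤ k → N y ≤ k → ∀ D : ℝ, 0 ≤ D →
      (∀ t : ℝ, 0 ≤ t → t ≤ T → ν x t ≤ ν y t + D) →
      Ufun ν q x ≤ Ufun ν q y + Real.exp T * D := by
    intro x y hx hy hxk hyk D hD hxy
    apply ciSup_le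
    intro t
    have h1 := le_ciSup (hB y hy hyk) t
    have h2 : Real.exp t * max 0 (ν x t - 1 / ((q:ℝ) + 1)) ≤
        Real.exp t * max 0 (ν y t - 1 / ((q:ℝ) + 1)) + Real.exp T * D := by
      by_cases htT : T ≤ t
      · rw [hvan x hx hxk t htT, hvan y hy hyk t htT]
        have : 0 ≤ Real.exp T * D := by positivity
        linarith
      · push Not at htT
        have h3 := hxy t t.2 htT.le
        have h4 : max 0 (ν x t - 1 / ((q:ℝ) + 1)) ≤ max 0 (ν y t - 1 / ((q:ℝ) + 1)) + D := by
          apply max_le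
          · have := le_max_left 0 (ν y t - 1 / ((q:ℝ) + 1))
            linarith
          · have := le_max_right 0 (ν y t - 1 / ((q:ℝ) + 1))
            linarith
        calc _ ≤ Real.exp t * (max 0 (ν y t - 1 / ((q:ℝ) + 1)) + D) :=
              mul_le_mul_of_nonneg_left h4 (Real.exp_pos _).le
          _ = Real.exp t * max 0 (ν y t - 1 / ((q:ℝ) + 1)) + Real.exp t * D := by ring
          _ ≤ _ := by
            have := mul_le_mul_of_nonneg_right (Real.exp_le_exp.2 htT.le) hD
            linarith
    exact h2.trans (add_le_add_left h1 _)
  intro x y hx hy hxk hyk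
  have hd := hδ x y hx hy
  have hMd : 0 ≤ M * δ x y := by positivity
  have a1 := key x y hx hy hxk hyk (M * δ x y) hMd (fun t h0 hT => by
    have := abs_le.1 (hM x y hx hy hxk hyk t h0 hT)
    linarith)
  have a2 := key y x hy hx hyk hxk (M * δ x y) hMd (fun t h0 hT => by
    have := abs_le.1 (hM x y hx hy hxk hyk t h0 hT)
    linarith)
  rw [abs_le]
  constructor <;> linarith

theorem core_converse {E : Type*} (Mem : E → Prop) (N : E → ℝ) (δ : E → E → ℝ) (ν : E → ℝ → ℝ)
    (σ : ℝ → ℝ → ℝ) (hσ : ClassKL σ)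
    (hN : ∀ x, Mem x → 0 ≤ N x) (hδ : ∀ x y, Mem x → Mem y → 0 ≤ δ x y)
    (hν : ∀ x, Mem x → ∀ t : ℝ, 0 ≤ t → ν x t ≤ σ (N x) t)
    (hν0 : ∀ x, Mem x → ν x 0 = N x)
    (hLip : ∀ R T : ℝ, ∃ M : ℝ, 0 ≤ M ∧ ∀ x y, Mem x → Mem y → N x ≤ R → N y ≤ R →
      ∀ t : ℝ, 0 ≤ t → t ≤ T → |ν x t - ν y t| ≤ M * δ x y)
    (o : E) (ho : Mem o) (hNo : N o = 0) (hδo : ∀ x, Mem x → δ x o = N x) :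
    ∃ V : E → ℝ, ∃ a1 a2 : ℝ → ℝ,
      (∀ x, Mem x → 0 ≤ V x) ∧
      (∀ R : ℝ, 0 < R → ∃ K : ℝ, ∀ x y, Mem x → Mem y →
        N x ≤ R → N y ≤ R → |V x - V y| ≤ K * δ x y) ∧
      ClassKInf a1 ∧ ClassKInf a2 ∧
      (∀ x, Mem x → a1 (N x) ≤ V x ∧ V x ≤ a2 (N x)) ∧
      (∀ x y, Mem x → Mem y → ∀ t : ℝ, 0 ≤ t → (∀ s : ℝ, 0 ≤ s → ν y s = ν x (t + s)) →
        V y ≤ Real.exp (-t) * V x) := by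
  have hU := Ufun_props Mem N δ ν σ hσ hN hδ hν hLip
  have hB : ∀ (q : ℕ) (x : E), Mem x →
      BddAbove (range fun t : ℝ≥0 => Real.exp t * max 0 (ν x t - 1 / ((q:ℝ) + 1))) := by
    intro q x hx
    exact (hU q ⌈N x⌉₊).1 x hx (Nat.le_ceil _)
  choose C hC0 hC using fun q k => (hU q k).2
  have hU0 : ∀ q x, 0 ≤ Ufun ν q x := fun q x =>
    Real.iSup_nonneg fun t => mul_nonneg (Real.exp_pos _).le (le_max_left _ _)
  have hUo : ∀ q, Ufun ν q o = 0 := by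
    intro q
    apply le_antisymm _ (hU0 q o)
    apply ciSup_le
    intro t
    have h1 := hν o ho t t.2
    rw [hNo, (hσ.2.1 t t.2).2.2] at h1
    have hq : (0:ℝ) < 1 / ((q:ℝ) + 1) := by positivity
    rw [max_eq_left (by linarith)]
    simp
  set w : ℕ → ℝ := fun q => (1/2)^q / (1 + C q q) with hw
  have hw0 : ∀ q, 0 < w q := fun q => by
    have := hC0 q q
    simp only [hw]
    positivity
  set C' : ℕ → ℕ → ℝ := fun q k => if k ≤ q then C q q else C q k with hC'
  have hC'0 : ∀ q k, 0 ≤ C' q k := by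
    intro q k
    simp only [hC']
    split_ifs
    · exact hC0 _ _
    · exact hC0 _ _
  have hC'L : ∀ (q k : ℕ) (x y : E), Mem x → Mem y → N x ≤ k → N y ≤ k →
      |Ufun ν q x - Ufun ν q y| ≤ C' q k * δ x y := by
    intro q k x y hx hy hxk hyk
    simp only [hC']
    split_ifs with h
    · have : (k:ℝ) ≤ q := by exact_mod_cast h
      exact hC q q x y hx hy (hxk.trans this) (hyk.trans this)
    · exact hC q k x y hx hy hxk hyk
  have hwle : ∀ q, w q ≤ (1/2)^q := by
    intro q
    apply div_le_self (by positivity)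
    have := hC0 q q
    linarith
  have hgeo : Summable (fun q : ℕ => ((1:ℝ)/2)^q) := summable_geometric_two
  have hwsum : Summable w := Summable.of_nonneg_of_le (fun q => (hw0 q).le) hwle hgeo
  have hsum : ∀ k, Summable (fun q => w q * C' q k) := by
    intro k
    rw [← summable_nat_add_iff k]
    refine Summable.of_nonneg_of_le (fun q => mul_nonneg (hw0 _).le (hC'0 _ _)) ?_
      ((summable_nat_add_iff k).2 hgeo)
    intro q
    have h1 : C' (q + k) k = C (q+k) (q+k) := by simp [hC']
    rw [h1]
    simp only [hw]
    have := hC0 (q+k) (q+k)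
    rw [div_mul_eq_mul_div, div_le_iff₀ (by linarith)]
    apply mul_le_mul_of_nonneg_left _ (by positivity)
    linarith
  have hUle : ∀ (q k : ℕ) (x : E), Mem x → N x ≤ k → Ufun ν q x ≤ C' q k * N x := by
    intro q k x hx hxk
    have := hC'L q k x o hx ho hxk (by rw [hNo]; positivity)
    rw [hUo, hδo x hx, sub_zero, abs_of_nonneg (hU0 q x)] at this
    exact this
  have hVsum : ∀ x, Mem x → Summable (fun q => w q * Ufun ν q x) := by
    intro x hx
    refine Summable.of_nonneg_of_le (fun q => mul_nonneg (hw0 _).le (hU0 _ _)) ?_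
      ((hsum ⌈N x⌉₊).mul_right (N x))
    intro q
    rw [mul_assoc]
    exact mul_le_mul_of_nonneg_left (hUle q _ x hx (Nat.le_ceil _)) (hw0 q).le
  set V : E → ℝ := fun x => ∑' q, w q * Ufun ν q x with hV
  have hVL : ∀ k : ℕ, ∀ x y, Mem x → Mem y → N x ≤ k → N y ≤ k →
      V x ≤ V y + (∑' q, w q * C' q k) * δ x y := by
    intro k x y hx hy hxk hyk
    simp only [hV]
    rw [← tsum_mul_right, ← (hVsum y hy).tsum_add ((hsum k).mul_right _)]
    refine (hVsum x hx).tsum_le_tsum ?_ ((hVsum y hy).add ((hsum k).mul_right _))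
    intro q
    have := (abs_le.1 (hC'L q k x y hx hy hxk hyk)).2
    have h2 := mul_le_mul_of_nonneg_left this (hw0 q).le
    nlinarith
  have hVL2 : ∀ k : ℕ, ∀ x y, Mem x → Mem y → N x ≤ k → N y ≤ k →
      V y ≤ V x + (∑' q, w q * C' q k) * δ x y := by
    intro k x y hx hy hxk hyk
    simp only [hV]
    rw [← tsum_mul_right, ← (hVsum x hx).tsum_add ((hsum k).mul_right _)]
    refine (hVsum y hy).tsum_le_tsum ?_ ((hVsum x hx).add ((hsum k).mul_right _))
    intro q
    have := (abs_le.1 (hC'L q k x y hx hy hxk hyk)).1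
    have h2 := mul_le_mul_of_nonneg_left this (hw0 q).le
    nlinarith
  have hVo : V o = 0 := by simp [hV, hUo]
  have hV0 : ∀ x, 0 ≤ V x := fun x => tsum_nonneg fun q => mul_nonneg (hw0 q).le (hU0 q x)
  obtain ⟨a2, ha2, ha2K⟩ := kinf_majorant (fun k => ∑' q, w q * C' q k)
  have hasum : ∀ s : ℝ, Summable (fun q : ℕ => w q * max 0 (s - 1 / ((q:ℝ) + 1))) := by
    intro s
    refine Summable.of_nonneg_of_le (fun q => mul_nonneg (hw0 _).le (le_max_left _ _)) ?_
      (hwsum.mul_right |s|)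
    intro q
    apply mul_le_mul_of_nonneg_left _ (hw0 q).le
    have hq : (0:ℝ) < 1 / ((q:ℝ) + 1) := by positivity
    apply max_le (abs_nonneg s)
    have := le_abs_self s
    linarith
  set a1 : ℝ → ℝ := fun s => ∑' q : ℕ, w q * max 0 (s - 1 / ((q:ℝ) + 1)) with ha1
  have ha1c : Continuous a1 := by
    have hL : ∀ s u : ℝ, s ≤ u → a1 u ≤ a1 s + (∑' q, w q) * (u - s) := by
      intro s u hsu
      simp only [ha1]
      rw [← tsum_mul_right, ← (hasum s).tsum_add (hwsum.mul_right _)]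
      refine (hasum u).tsum_le_tsum ?_ ((hasum s).add (hwsum.mul_right _))
      intro q
      rw [← mul_add]
      apply mul_le_mul_of_nonneg_left _ (hw0 q).le
      have h1 := le_max_left 0 (s - 1 / ((q:ℝ) + 1))
      have h2 := le_max_right 0 (s - 1 / ((q:ℝ) + 1))
      apply max_le <;> linarith
    have hM : Monotone a1 := by
      intro s u hsu
      refine (hasum s).tsum_le_tsum ?_ (hasum u)
      intro q
      apply mul_le_mul_of_nonneg_left _ (hw0 q).le
      exact max_le_max le_rfl (by linarith)
    have hW : 0 ≤ ∑' q, w q := tsum_nonneg fun q => (hw0 q).le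
    have : LipschitzWith (Real.toNNReal (∑' q, w q)) a1 := by
      apply LipschitzWith.of_le_add_mul
      intro s u
      rw [Real.coe_toNNReal _ hW, Real.dist_eq]
      rcases le_total u s with h | h
      · rw [abs_of_nonneg (by linarith)]
        exact hL u s h
      · have := hM h
        have := mul_nonneg hW (abs_nonneg (s - u))
        linarith
    exact this.continuous
  refine ⟨V, a1, a2, fun x _ => hV0 x, ?_, ⟨?_, ha1c.continuousOn, ?_, ?_, ?_⟩, ha2, ?_, ?_⟩
  · intro R hR
    refine ⟨∑' q, w q * C' q ⌈R⌉₊, ?_⟩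
    intro x y hx hy hxR hyR
    have h1 := hVL ⌈R⌉₊ x y hx hy (hxR.trans (Nat.le_ceil _)) (hyR.trans (Nat.le_ceil _))
    have h2 := hVL2 ⌈R⌉₊ x y hx hy (hxR.trans (Nat.le_ceil _)) (hyR.trans (Nat.le_ceil _))
    rw [abs_le]
    constructor <;> linarith
  · intro s _
    exact tsum_nonneg fun q => mul_nonneg (hw0 _).le (le_max_left _ _)
  · intro s hs u hu hsu
    have hs' : (0:ℝ) ≤ s := hs
    obtain ⟨q, hq⟩ := exists_nat_one_div_lt (lt_of_le_of_lt hs' hsu)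
    refine Summable.tsum_lt_tsum (i := q) ?_ ?_ (hasum s) (hasum u)
    · intro q
      apply mul_le_mul_of_nonneg_left _ (hw0 q).le
      exact max_le_max le_rfl (by linarith)
    · apply mul_lt_mul_of_pos_left _ (hw0 q)
      rw [max_eq_right (a := 0) (b := u - _) (by linarith)]
      apply max_lt <;> linarith
  · have : ∀ q : ℕ, w q * max 0 (0 - 1 / ((q:ℝ) + 1)) = 0 := by
      intro q
      have hq : (0:ℝ) < 1 / ((q:ℝ) + 1) := by positivity
      rw [max_eq_left (by linarith), mul_zero]
    simp only [ha1]
    rw [tsum_congr this, tsum_zero]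
  · have h1 : ∀ s : ℝ, w 0 * (s - 1) ≤ a1 s := by
      intro s
      have := (hasum s).le_tsum 0 (fun q _ => mul_nonneg (hw0 _).le (le_max_left _ _))
      refine le_trans ?_ this
      apply mul_le_mul_of_nonneg_left _ (hw0 0).le
      refine le_trans ?_ (le_max_right _ _)
      norm_num
    refine tendsto_atTop_mono h1 ?_
    apply Tendsto.const_mul_atTop (hw0 0)
    exact tendsto_atTop_add_const_right _ (-1) tendsto_id
  · intro x hx
    constructor
    · refine (hasum (N x)).tsum_le_tsum ?_ (hVsum x hx)
      intro q
      apply mul_le_mul_of_nonneg_left _ (hw0 q).le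
      have := le_ciSup (hB q x hx) 0
      simp only [NNReal.coe_zero, Real.exp_zero, one_mul, hν0 x hx] at this
      exact this
    · obtain ⟨k, hk, hka⟩ := ha2K (N x) (hN x hx)
      have := hVL k x o hx ho hk (by rw [hNo]; positivity)
      rw [hVo, hδo x hx, zero_add] at this
      exact this.trans hka
  · intro x y hx hy t ht hst
    simp only [hV]
    rw [← tsum_mul_left]
    refine (hVsum y hy).tsum_le_tsum ?_ ((hVsum x hx).mul_left _)
    intro q
    rw [mul_left_comm]
    apply mul_le_mul_of_nonneg_left _ (hw0 q).le
    apply ciSup_le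
    intro s
    rw [hst s s.2]
    have := le_ciSup (hB q x hx) (Real.toNNReal t + s)
    simp only [NNReal.coe_add, Real.coe_toNNReal t ht] at this
    calc Real.exp s * max 0 (ν x (t + s) - 1 / ((q:ℝ) + 1))
        = Real.exp (-t) * (Real.exp (t + s) * max 0 (ν x (t + s) - 1 / ((q:ℝ) + 1))) := by
          rw [← mul_assoc, ← Real.exp_add]
          congr 2
          ring
      _ ≤ _ := mul_le_mul_of_nonneg_left this (Real.exp_pos _).le

/-! ### Sup norm and solutions -/

theorem supN_le {r A : ℝ} {g : ℝ → Vec n} (hA : 0 ≤ A) (h : ∀ s ∈ Icc (-r) 0, ‖g s‖ ≤ A) :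
    supN r g ≤ A := by
  apply Real.sSup_le _ hA
  rintro _ ⟨s, hs, rfl⟩
  exact h s hs

theorem le_supN {r : ℝ} {g : ℝ → Vec n} (hg : MemC0 r g) {s : ℝ} (hs : s ∈ Icc (-r) 0) :
    ‖g s‖ ≤ supN r g := by
  refine le_csSup ?_ (mem_image_of_mem (fun s => ‖g s‖) hs)
  exact (isCompact_Icc.image_of_continuousOn hg.norm).bddAbove

theorem supN_nonneg (r : ℝ) (g : ℝ → Vec n) : 0 ≤ supN r g := by
  apply Real.sSup_nonneg
  rintro _ ⟨s, hs, rfl⟩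
  exact norm_nonneg _

theorem supN_congr {r : ℝ} {g h : ℝ → Vec n} (e : EqOn g h (Icc (-r) 0)) :
    supN r g = supN r h := by
  unfold supN
  congr 1
  apply image_congr
  intro s hs
  rw [e hs]

/-- What we need of the state space. -/
structure GoodX (n : ℕ) (r α : ℝ) (Mem : (ℝ → Vec n) → Prop) (N : (ℝ → Vec n) → ℝ) : Prop where
  sub : ∀ x y, Mem x → Mem y → Mem (x - y)
  zero_mem : Mem 0
  zero_norm : N 0 = 0
  congr_mem : ∀ x y, EqOn x y (Icc (-r) 0) → Mem x → Mem y
  congr_norm : ∀ x y, EqOn x y (Icc (-r) 0) → Mem x → N x = N y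
  nonneg : ∀ x, 0 ≤ N x
  tri : ∀ x y, Mem x → Mem y → |N x - N y| ≤ N (x - y)
  hol : ∀ x, Mem x → MemHol r α x
  sup_le : ∀ x, Mem x → supN r x ≤ N x
  concat : ∃ C : ℝ, 0 ≤ C ∧ ∀ (z h : ℝ → Vec n) (T A B : ℝ), 0 ≤ T → 0 ≤ A → 0 ≤ B → Mem z →
    ContinuousOn z (Icc (-r) T) → ContinuousOn h (Icc 0 T) →
    (∀ t ∈ Icc 0 T, z t = z 0 + ∫ s in (0:ℝ)..t, h s) →
    (∀ t ∈ Icc (-r) T, ‖z t‖ ≤ A) → (∀ t ∈ Icc 0 T, ‖h t‖ ≤ B) →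
    ∀ t ∈ Icc 0 T, Mem (seg r z t) ∧ N (seg r z t) ≤ C * (N z + A + B)

theorem IsSol.cont {r : ℝ} {f : (ℝ → Vec n) → Vec n} {x0 x : ℝ → Vec n}
    (h : IsSol r f x0 x ⊤) : ContinuousOn x (Ici (-r)) := by
  apply h.1.mono
  intro t ht
  exact ⟨ht, ENNReal.ofReal_lt_top⟩

theorem IsSol.eqn {r : ℝ} {f : (ℝ → Vec n) → Vec n} {x0 x : ℝ → Vec n}
    (h : IsSol r f x0 x ⊤) {t : ℝ} (ht : 0 ≤ t) :
    x t = x 0 + ∫ s in (0:ℝ)..t, f (seg r x s) := h.2.2 t ht ENNReal.ofReal_lt_top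

theorem seg_memC0 {r T : ℝ} {x : ℝ → Vec n} (hx : ContinuousOn x (Icc (-r) T)) {t : ℝ}
    (ht : t ∈ Icc 0 T) : MemC0 r (seg r x t) := by
  apply hx.comp (by fun_prop)
  intro s hs
  exact ⟨by linarith [ht.1, hs.1], by linarith [ht.2, hs.2]⟩

theorem rhs_cont {r : ℝ} {f : (ℝ → Vec n) → Vec n} {L : ℝ → ℝ}
    (hf : GoodRHS r f L) {x : ℝ → Vec n} {T : ℝ} (hx : ContinuousOn x (Icc (-r) T)) :
    ContinuousOn (fun s => f (seg r x s)) (Icc 0 T) := by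
  obtain ⟨R, hR⟩ := isCompact_Icc.exists_bound_of_continuousOn hx
  have hu := isCompact_Icc.uniformContinuousOn_of_continuous hx
  rw [Metric.uniformContinuousOn_iff] at hu
  rw [Metric.continuousOn_iff]
  intro b hb ε hε
  have hL := hf.2.2.2.1 (max R 0)
  obtain ⟨δ, hδ, hd⟩ := hu (ε / (L (max R 0) + 1)) (by positivity)
  refine ⟨δ, hδ, ?_⟩
  intro a ha hab
  have hin : ∀ c ∈ Icc 0 T, ∀ s ∈ Icc (-r) 0, c + s ∈ Icc (-r) T := fun c hc s hs =>
    ⟨by linarith [hc.1, hs.1], by linarith [hc.2, hs.2]⟩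
  have hsup : ∀ c ∈ Icc 0 T, supN r (seg r x c) ≤ max R 0 := fun c hc =>
    supN_le (le_max_right _ _) fun s hs => (hR _ (hin c hc s hs)).trans (le_max_left _ _)
  have h1 := hf.2.2.2.2 (max R 0) (seg r x a) (seg r x b) (seg_memC0 hx ha) (seg_memC0 hx hb)
    (hsup a ha) (hsup b hb)
  have h2 : supN r (seg r x a - seg r x b) ≤ ε / (L (max R 0) + 1) := by
    apply supN_le (by positivity)
    intro s hs
    have := hd (a + s) (hin a ha s hs) (b + s) (hin b hb s hs) (by
      rw [Real.dist_eq] at hab ⊢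
      simpa using hab)
    rw [dist_eq_norm] at this
    exact this.le
  rw [dist_eq_norm]
  calc _ ≤ L (max R 0) * (ε / (L (max R 0) + 1)) := h1.trans (mul_le_mul_of_nonneg_left h2 hL)
    _ < ε := by
      rw [mul_div_assoc', div_lt_iff₀ (by linarith)]
      nlinarith

theorem delay_gronwall {r T Λ : ℝ} (hr : 0 < r) (hT : 0 ≤ T) (hΛ : 0 ≤ Λ) {w h : ℝ → Vec n}
    (hw : ContinuousOn w (Icc (-r) T))
    (he : ∀ t ∈ Icc 0 T, w t = w 0 + ∫ s in (0:ℝ)..t, h s)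
    (hb : ∀ t ∈ Icc 0 T, ‖h t‖ ≤ Λ * supN r (seg r w t)) :
    ∀ t ∈ Icc (-r) T, ‖w t‖ ≤ 2 * Real.exp ((2 * Λ + 1) * T) * supN r w := by
  set l := 2 * Λ + 1 with hl
  have hlpos : 0 < l := by positivity
  have hF : ContinuousOn (fun t => ‖w t‖ * Real.exp (-(l * max t 0))) (Icc (-r) T) :=
    hw.norm.mul (by fun_prop)
  obtain ⟨τ, hτ, hmax⟩ := isCompact_Icc.exists_isMaxOn (nonempty_Icc.2 (by linarith)) hF
  set m := ‖w τ‖ * Real.exp (-(l * max τ 0)) with hm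
  have hm0 : 0 ≤ m := by positivity
  have hC0 : MemC0 r w := hw.mono (Icc_subset_Icc le_rfl hT)
  have hδ := supN_nonneg r w
  have hwb : ∀ t ∈ Icc (-r) T, ‖w t‖ ≤ m * Real.exp (l * max t 0) := by
    intro t ht
    have h1 : ‖w t‖ * Real.exp (-(l * max t 0)) ≤ m := hmax ht
    rw [Real.exp_neg] at h1
    rwa [← div_eq_mul_inv, div_le_iff₀ (Real.exp_pos _)] at h1
  have hm2 : m ≤ 2 * supN r w := by
    rcases le_total τ 0 with h0 | h0
    · have : m = ‖w τ‖ := by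
        rw [hm, max_eq_right h0]
        simp
      rw [this]
      have := le_supN hC0 (s := τ) ⟨hτ.1, h0⟩
      linarith
    · have h1 : ‖∫ s in (0:ℝ)..τ, h s‖ ≤ ∫ s in (0:ℝ)..τ, Λ * m * Real.exp (l * s) := by
        apply intervalIntegral.norm_integral_le_of_norm_le h0
        · refine Eventually.of_forall fun s hs => ?_
          have hsT : s ∈ Icc 0 T := ⟨hs.1.le, hs.2.trans hτ.2⟩
          refine (hb s hsT).trans ?_
          rw [mul_assoc]
          apply mul_le_mul_of_nonneg_left _ hΛ
          apply supN_le (by positivity)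
          intro u hu
          refine (hwb (s + u) ⟨by linarith [hsT.1, hu.1], by linarith [hsT.2, hu.2]⟩).trans ?_
          apply mul_le_mul_of_nonneg_left _ hm0
          apply Real.exp_le_exp.2
          apply mul_le_mul_of_nonneg_left _ hlpos.le
          exact max_le (by linarith [hu.2]) hsT.1
        · exact Continuous.intervalIntegrable (by fun_prop) _ _
      have h2 : ∫ s in (0:ℝ)..τ, Λ * m * Real.exp (l * s) =
          Λ * m / l * Real.exp (l * τ) - Λ * m / l * Real.exp (l * 0) := by
        apply intervalIntegral.integral_eq_sub_of_hasDerivAt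
          (f := fun s => Λ * m / l * Real.exp (l * s))
        · intro s _
          have h3 : HasDerivAt (fun s : ℝ => l * s) l s := by
            simpa using (hasDerivAt_id s).const_mul l
          have h3' := (h3.exp).const_mul (Λ * m / l)
          have h3e : Λ * m / l * (Real.exp (l * s) * l) = Λ * m * Real.exp (l * s) := by
            field_simp
          rw [h3e] at h3'
          exact h3'
        · exact Continuous.intervalIntegrable (by fun_prop) _ _
      have h4 : ‖w τ‖ ≤ supN r w + Λ * m / l * Real.exp (l * τ) := by
        rw [he τ ⟨h0, hτ.2⟩]
        have h5 := norm_add_le (w 0) (∫ s in (0:ℝ)..τ, h s)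
        have h6 := le_supN hC0 (s := 0) ⟨by linarith, le_rfl⟩
        have h7 : 0 ≤ Λ * m / l * Real.exp (l * 0) := by positivity
        linarith
      have h8 : ‖w τ‖ = m * Real.exp (l * τ) := by
        rw [hm, max_eq_left h0, mul_assoc, ← Real.exp_add]
        simp
      have h9 : 1 ≤ Real.exp (l * τ) := Real.one_le_exp (by positivity)
      have h10 : Λ * m / l ≤ m / 2 := by
        rw [div_le_div_iff₀ hlpos two_pos]
        nlinarith
      have h11 : m * Real.exp (l * τ) ≤ (supN r w + m / 2) * Real.exp (l * τ) := by
        rw [← h8, add_mul]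
        have h12 := mul_le_mul_of_nonneg_right h10 (Real.exp_pos (l * τ)).le
        have h13 := mul_le_mul_of_nonneg_left h9 hδ
        linarith
      have h14 := le_of_mul_le_mul_right h11 (Real.exp_pos _)
      linarith
  intro t ht
  calc ‖w t‖ ≤ m * Real.exp (l * max t 0) := hwb t ht
    _ ≤ (2 * supN r w) * Real.exp (l * T) := by
      apply mul_le_mul hm2 _ (Real.exp_pos _).le (by positivity)
      apply Real.exp_le_exp.2
      apply mul_le_mul_of_nonneg_left _ hlpos.le
      exact max_le ht.2 hT
    _ = _ := by ring

theorem seg_seg (r : ℝ) (x : ℝ → Vec n) (t s : ℝ) : seg r (seg r x t) s = seg r x (t + s) := by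
  funext u
  simp [seg, add_assoc]

theorem IsSol.shift {r : ℝ} (hr : 0 < r) {f : (ℝ → Vec n) → Vec n} {L : ℝ → ℝ}
    (hf : GoodRHS r f L)
    {x0 x : ℝ → Vec n} (h : IsSol r f x0 x ⊤) {t : ℝ} (ht : 0 ≤ t) :
    IsSol r f (seg r x t) (seg r x t) ⊤ := by
  refine ⟨?_, fun _ _ => rfl, ?_⟩
  · apply h.cont.comp (by fun_prop)
    intro s hs
    have := hs.1
    simp only [mem_Ici]
    linarith
  · intro τ hτ _
    have hIntg : ∀ a b : ℝ, 0 ≤ a → a ≤ b →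
        IntervalIntegrable (fun s => f (seg r x s)) volume a b := by
      intro a b ha hab
      apply ContinuousOn.intervalIntegrable_of_Icc hab
      exact (rhs_cont hf (h.cont.mono Icc_subset_Ici_self)).mono (Icc_subset_Icc ha le_rfl)
    simp only [seg_seg]
    rw [intervalIntegral.integral_comp_add_left (fun s => f (seg r x s))]
    simp only [seg, add_zero]
    rw [h.eqn (t := t + τ) (by linarith), h.eqn ht, add_assoc]
    congr 1
    exact (intervalIntegral.integral_add_adjacent_intervals (hIntg 0 t le_rfl ht)
      (hIntg t (t + τ) ht (by linarith))).symm

theorem GoodX.seg_mem {r α : ℝ} {Mem : (ℝ → Vec n) → Prop} {N : (ℝ → Vec n) → ℝ}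
    (hX : GoodX n r α Mem N) {f : (ℝ → Vec n) → Vec n} {L : ℝ → ℝ}
    (hf : GoodRHS r f L) {x0 x : ℝ → Vec n} (hx0 : Mem x0) (h : IsSol r f x0 x ⊤) {t : ℝ}
    (ht : 0 ≤ t) : Mem (seg r x t) := by
  obtain ⟨C, hC, hcon⟩ := hX.concat
  have hc : ContinuousOn x (Icc (-r) t) := h.cont.mono Icc_subset_Ici_self
  have hh := rhs_cont hf hc
  obtain ⟨A, hA⟩ := isCompact_Icc.exists_bound_of_continuousOn hc
  obtain ⟨B, hB⟩ := isCompact_Icc.exists_bound_of_continuousOn hh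
  exact (hcon x _ t (max A 0) (max B 0) ht (le_max_right _ _) (le_max_right _ _)
    (hX.congr_mem _ _ h.2.1.symm hx0) hc hh (fun s hs => h.eqn hs.1)
    (fun s hs => (hA s hs).trans (le_max_left _ _)) (fun s hs => (hB s hs).trans (le_max_left _ _))
    t ⟨ht, le_rfl⟩).1

theorem GoodX.seg_lip {r α : ℝ} (hr : 0 < r) {Mem : (ℝ → Vec n) → Prop} {N : (ℝ → Vec n) → ℝ}
    (hX : GoodX n r α Mem N) {f : (ℝ → Vec n) → Vec n} {L : ℝ → ℝ}
    (hf : GoodRHS r f L) (T R : ℝ) (hT : 0 ≤ T) :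
    ∃ M : ℝ, 0 ≤ M ∧ ∀ x0 y0 x y : ℝ → Vec n, Mem x0 → Mem y0 → IsSol r f x0 x ⊤ →
      IsSol r f y0 y ⊤ → (∀ t ∈ Icc 0 T, supN r (seg r x t) ≤ R) →
      (∀ t ∈ Icc 0 T, supN r (seg r y t) ≤ R) →
      ∀ t ∈ Icc 0 T, N (seg r x t - seg r y t) ≤ M * N (x0 - y0) := by
  obtain ⟨C, hC, hcon⟩ := hX.concat
  have hL := hf.2.2.2.1 R
  set a := 2 * Real.exp ((2 * L R + 1) * T) with ha
  have ha0 : 0 ≤ a := by positivity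
  refine ⟨C * (1 + a + L R * a), by positivity, ?_⟩
  intro x0 y0 x y hx0 hy0 hx hy hxR hyR t ht
  have hcx : ContinuousOn x (Icc (-r) T) := hx.cont.mono Icc_subset_Ici_self
  have hcy : ContinuousOn y (Icc (-r) T) := hy.cont.mono Icc_subset_Ici_self
  have hhx := rhs_cont hf hcx
  have hhy := rhs_cont hf hcy
  have hw : ContinuousOn (x - y) (Icc (-r) T) := hcx.sub hcy
  have hh : ContinuousOn (fun s => f (seg r x s) - f (seg r y s)) (Icc 0 T) := hhx.sub hhy
  have heqon : EqOn (x0 - y0) (x - y) (Icc (-r) 0) := by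
    intro s hs
    simp [hx.2.1 hs, hy.2.1 hs]
  have hmem0 := hX.sub x0 y0 hx0 hy0
  have hmem : Mem (x - y) := hX.congr_mem _ _ heqon hmem0
  have hnorm := hX.congr_norm _ _ heqon hmem0
  have he : ∀ t ∈ Icc 0 T, (x - y) t =
      (x - y) 0 + ∫ s in (0:ℝ)..t, (f (seg r x s) - f (seg r y s)) := by
    intro t ht
    rw [intervalIntegral.integral_sub, Pi.sub_apply, Pi.sub_apply, hx.eqn ht.1, hy.eqn ht.1]
    · abel
    · exact (hhx.mono (Icc_subset_Icc le_rfl ht.2)).intervalIntegrable_of_Icc ht.1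
    · exact (hhy.mono (Icc_subset_Icc le_rfl ht.2)).intervalIntegrable_of_Icc ht.1
  have hb : ∀ t ∈ Icc 0 T, ‖f (seg r x t) - f (seg r y t)‖ ≤ L R * supN r (seg r (x - y) t) :=
    fun t ht => hf.2.2.2.2 R _ _ (seg_memC0 hcx ht) (seg_memC0 hcy ht) (hxR t ht) (hyR t ht)
  have hg := delay_gronwall hr hT hL hw he hb
  have hN0 := hX.nonneg (x - y)
  have hs := hX.sup_le _ hmem
  have hg' : ∀ t ∈ Icc (-r) T, ‖(x - y) t‖ ≤ a * N (x - y) := fun t ht =>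
    (hg t ht).trans (mul_le_mul_of_nonneg_left hs ha0)
  have hB : ∀ t ∈ Icc 0 T, ‖f (seg r x t) - f (seg r y t)‖ ≤ L R * (a * N (x - y)) := by
    intro t ht
    refine (hb t ht).trans (mul_le_mul_of_nonneg_left ?_ hL)
    apply supN_le (by positivity)
    intro s hs
    exact hg' (t + s) ⟨by linarith [ht.1, hs.1], by linarith [ht.2, hs.2]⟩
  have := (hcon (x - y) _ T (a * N (x - y)) (L R * (a * N (x - y))) hT (by positivity)
    (by positivity) hmem hw hh he hg' hB t ht).2
  rw [hnorm]
  calc N (seg r x t - seg r y t) = N (seg r (x - y) t) := rfl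
    _ ≤ _ := this
    _ = _ := by ring

theorem GoodX.converse {r α : ℝ} (hr : 0 < r) {Mem : (ℝ → Vec n) → Prop} {N : (ℝ → Vec n) → ℝ}
    (hX : GoodX n r α Mem N) {f : (ℝ → Vec n) → Vec n} {L : ℝ → ℝ}
    (hf : GoodRHS r f L)
    (hFC : ∀ x0 : ℝ → Vec n, MemHol r α x0 → ∃ x : ℝ → Vec n, IsSol r f x0 x ⊤)
    (σ : ℝ → ℝ → ℝ) (hσ : ClassKL σ) (hKL : ∀ x0 x : ℝ → Vec n, Mem x0 →
        IsSol r f x0 x ⊤ → ∀ t : ℝ, 0 ≤ t → N (seg r x t) ≤ σ (N x0) t) :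
    (∃ V : (ℝ → Vec n) → ℝ, ∃ a1 a2 : ℝ → ℝ,
      (∀ x : ℝ → Vec n, Mem x → 0 ≤ V x) ∧
      (∀ R : ℝ, 0 < R → ∃ K : ℝ, ∀ x y : ℝ → Vec n, Mem x → Mem y →
        N x ≤ R → N y ≤ R → |V x - V y| ≤ K * N (x - y)) ∧
      ClassKInf a1 ∧ ClassKInf a2 ∧
      (∀ x : ℝ → Vec n, Mem x → a1 (N x) ≤ V x ∧ V x ≤ a2 (N x)) ∧
      (∀ x0 x : ℝ → Vec n, Mem x0 → IsSol r f x0 x ⊤ →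
        ∀ t : ℝ, 0 ≤ t → V (seg r x t) ≤ Real.exp (-t) * V x0)) := by
  have hex : ∀ x0, Mem x0 → ∃ x : ℝ → Vec n, IsSol r f x0 x ⊤ := fun x0 h => hFC x0 (hX.hol x0 h)
  choose! φ hφ using hex
  have hLip : ∀ R T : ℝ, ∃ M : ℝ, 0 ≤ M ∧ ∀ x0 y0 x y : ℝ → Vec n, Mem x0 → Mem y0 →
      N x0 ≤ R → N y0 ≤ R → IsSol r f x0 x ⊤ → IsSol r f y0 y ⊤ → ∀ t : ℝ, 0 ≤ t → t ≤ T →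
      |N (seg r x t) - N (seg r y t)| ≤ M * N (x0 - y0) := by
    intro R T
    obtain ⟨M, hM0, hM⟩ := hX.seg_lip hr hf (max T 0) (σ (max R 0) 0) (le_max_right _ _)
    refine ⟨M, hM0, ?_⟩
    intro x0 y0 x y hx0 hy0 hxR hyR hx hy t ht0 htT
    have hbd : ∀ z0 z : ℝ → Vec n, Mem z0 → N z0 ≤ R → IsSol r f z0 z ⊤ →
        ∀ t ∈ Icc 0 (max T 0), supN r (seg r z t) ≤ σ (max R 0) 0 := by
      intro z0 z hz0 hzR hz t ht
      calc supN r (seg r z t) ≤ N (seg r z t) := hX.sup_le _ (hX.seg_mem hf hz0 hz ht.1)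
        _ ≤ σ (N z0) t := hKL z0 z hz0 hz t ht.1
        _ ≤ σ (N z0) 0 := (hσ.2.2 (N z0) (hX.nonneg _)).1 (by simp) ht.1 ht.1
        _ ≤ σ (max R 0) 0 := (hσ.2.1 0 le_rfl).2.1.monotoneOn (hX.nonneg _) (by simp)
          (hzR.trans (le_max_left _ _))
    refine (hX.tri _ _ (hX.seg_mem hf hx0 hx ht0) (hX.seg_mem hf hy0 hy ht0)).trans ?_
    exact hM x0 y0 x y hx0 hy0 hx hy (hbd _ _ hx0 hxR hx) (hbd _ _ hy0 hyR hy) t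
      ⟨ht0, htT.trans (le_max_left _ _)⟩
  have huniq : ∀ x0 x y : ℝ → Vec n, Mem x0 → IsSol r f x0 x ⊤ → IsSol r f x0 y ⊤ →
      ∀ t : ℝ, 0 ≤ t → N (seg r x t) = N (seg r y t) := by
    intro x0 x y hx0 hx hy t ht
    obtain ⟨M, hM0, hM⟩ := hLip (N x0) t
    have := hM x0 x0 x y hx0 hx0 le_rfl le_rfl hx hy t ht le_rfl
    rw [sub_self, hX.zero_norm, mul_zero] at this
    exact sub_eq_zero.1 (abs_nonpos_iff.1 this)
  obtain ⟨V, a1, a2, h1, h2, h3, h4, h5, h6⟩ := core_converse Mem N (fun x y => N (x - y))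
    (fun x t => N (seg r (φ x) t)) σ hσ (fun x _ => hX.nonneg x) (fun x y _ _ => hX.nonneg _)
    (fun x hx t ht => hKL x (φ x) hx (hφ x hx) t ht)
    (by
      intro x hx
      refine (hX.congr_norm _ _ ?_ hx).symm
      intro s hs
      simp [seg, (hφ x hx).2.1 hs])
    (by
      intro R T
      obtain ⟨M, hM0, hM⟩ := hLip R T
      exact ⟨M, hM0, fun x y hx hy hxR hyR t h0 hT =>
        hM x y _ _ hx hy hxR hyR (hφ x hx) (hφ y hy) t h0 hT⟩)
    0 hX.zero_mem hX.zero_norm (by simp)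
  refine ⟨V, a1, a2, h1, h2, h3, h4, h5, ?_⟩
  intro x0 x hx0 hx t ht
  have hm := hX.seg_mem hf hx0 hx ht
  apply h6 x0 (seg r x t) hx0 hm t ht
  intro s hs
  have e1 := huniq (seg r x t) _ _ hm (hφ _ hm) (hx.shift hr hf ht) s hs
  have e2 := huniq x0 _ _ hx0 hx (hφ _ hx0) (t + s) (by linarith)
  rw [seg_seg] at e1
  exact e1.trans e2

theorem GoodX.direct {r α : ℝ} {Mem : (ℝ → Vec n) → Prop} {N : (ℝ → Vec n) → ℝ}
    (hX : GoodX n r α Mem N) {f : (ℝ → Vec n) → Vec n} {L : ℝ → ℝ}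
    (hf : GoodRHS r f L) (V : (ℝ → Vec n) → ℝ) (a1 a2 : ℝ → ℝ)
    (ha1 : ClassKInf a1) (ha2 : ClassKInf a2)
    (hV : ∀ x : ℝ → Vec n, Mem x → a1 (N x) ≤ V x ∧ V x ≤ a2 (N x))
    (hd : ∀ x0 x : ℝ → Vec n, Mem x0 → IsSol r f x0 x ⊤ →
        ∀ t : ℝ, 0 ≤ t → V (seg r x t) ≤ Real.exp (-t) * V x0) :
    ∃ σ : ℝ → ℝ → ℝ, ClassKL σ ∧ ∀ x0 x : ℝ → Vec n, Mem x0 →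
        IsSol r f x0 x ⊤ → ∀ t : ℝ, 0 ≤ t → N (seg r x t) ≤ σ (N x0) t := by
  obtain ⟨b, hb, hba⟩ := kinf_inverse a1 ha1
  refine ⟨_, kl_of_kinf b a2 hb ha2, ?_⟩
  intro x0 x hx0 hx t ht
  have hm := hX.seg_mem hf hx0 hx ht
  apply hba _ _ (hX.nonneg _) (mul_nonneg (Real.exp_pos _).le (ha2.1 _ (hX.nonneg _)))
  calc _ ≤ V (seg r x t) := (hV _ hm).1
    _ ≤ Real.exp (-t) * V x0 := hd x0 x hx0 hx t ht
    _ ≤ _ := mul_le_mul_of_nonneg_left (hV x0 hx0).2 (Real.exp_pos _).le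

/-! ### The Hölder space -/

theorem hol_semi_nonneg (r α : ℝ) (g : ℝ → Vec n) : 0 ≤ sSup (hRatios α (Icc (-r) 0) g) := by
  apply Real.sSup_nonneg
  rintro _ ⟨t, _, s, _, _, rfl⟩
  positivity

theorem hol_ratio {r α : ℝ} {g : ℝ → Vec n} (hg : MemHol r α g) {t s : ℝ}
    (ht : t ∈ Icc (-r) 0) (hs : s ∈ Icc (-r) 0) :
    ‖g t - g s‖ ≤ sSup (hRatios α (Icc (-r) 0) g) * |t - s| ^ α := by
  have h0 := hol_semi_nonneg r α g
  by_cases hts : t = s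
  · subst hts
    simp only [sub_self, norm_zero]
    positivity
  · have hpos : 0 < |t - s| ^ α := Real.rpow_pos_of_pos (abs_pos.2 (sub_ne_zero.2 hts)) _
    rw [← div_le_iff₀ hpos]
    exact le_csSup hg.2 ⟨t, ht, s, hs, hts, rfl⟩

theorem hol_of_bound {r α K : ℝ} (hK : 0 ≤ K) {g : ℝ → Vec n}
    (h : ∀ t ∈ Icc (-r) 0, ∀ s ∈ Icc (-r) 0, ‖g t - g s‖ ≤ K * |t - s| ^ α) :
    BddAbove (hRatios α (Icc (-r) 0) g) ∧ sSup (hRatios α (Icc (-r) 0) g) ≤ K := by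
  have key : ∀ c ∈ hRatios α (Icc (-r) 0) g, c ≤ K := by
    rintro _ ⟨t, ht, s, hs, hts, rfl⟩
    have hpos : 0 < |t - s| ^ α := Real.rpow_pos_of_pos (abs_pos.2 (sub_ne_zero.2 hts)) _
    rw [div_le_iff₀ hpos]
    exact h t ht s hs
  exact ⟨⟨K, key⟩, Real.sSup_le key hK⟩

theorem supN_sub_le {r : ℝ} {x y : ℝ → Vec n} (hx : MemC0 r x) (hy : MemC0 r y) :
    supN r x ≤ supN r y + supN r (x - y) := by
  apply supN_le (add_nonneg (supN_nonneg _ _) (supN_nonneg _ _))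
  intro s hs
  have h1 := le_supN hy hs
  have h2 := le_supN (g := x - y) (hx.sub hy) hs
  have h3 : x s = y s + (x - y) s := by simp
  rw [h3]
  exact (norm_add_le _ _).trans (add_le_add h1 h2)

theorem supN_sub_comm (r : ℝ) (x y : ℝ → Vec n) : supN r (x - y) = supN r (y - x) := by
  unfold supN
  congr 1
  apply image_congr
  intro s _
  simp [norm_sub_rev]

theorem hol_sub_bound {r α : ℝ} {x y : ℝ → Vec n} (hx : MemHol r α x) (hy : MemHol r α y) :
    BddAbove (hRatios α (Icc (-r) 0) (x - y)) ∧ sSup (hRatios α (Icc (-r) 0) (x - y)) ≤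
      sSup (hRatios α (Icc (-r) 0) x) + sSup (hRatios α (Icc (-r) 0) y) := by
  apply hol_of_bound (add_nonneg (hol_semi_nonneg _ _ _) (hol_semi_nonneg _ _ _))
  intro t ht s hs
  have h1 := hol_ratio hx ht hs
  have h2 := hol_ratio hy ht hs
  have h3 : (x - y) t - (x - y) s = (x t - x s) - (y t - y s) := by
    simp only [Pi.sub_apply]
    abel
  rw [h3, add_mul]
  exact (norm_sub_le _ _).trans (add_le_add h1 h2)

theorem hRatios_congr {r α : ℝ} {x y : ℝ → Vec n} (e : EqOn x y (Icc (-r) 0)) :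
    hRatios α (Icc (-r) 0) x = hRatios α (Icc (-r) 0) y := by
  ext c
  constructor
  · rintro ⟨t, ht, s, hs, hts, rfl⟩
    exact ⟨t, ht, s, hs, hts, by rw [e ht, e hs]⟩
  · rintro ⟨t, ht, s, hs, hts, rfl⟩
    exact ⟨t, ht, s, hs, hts, by rw [e ht, e hs]⟩

theorem hRatios_sub_comm (r α : ℝ) (x y : ℝ → Vec n) :
    hRatios α (Icc (-r) 0) (x - y) = hRatios α (Icc (-r) 0) (y - x) := by
  have : ∀ x y : ℝ → Vec n, ∀ t s : ℝ, ‖(x - y) t - (x - y) s‖ = ‖(y - x) t - (y - x) s‖ := by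
    intro x y t s
    rw [← norm_neg]
    congr 1
    simp only [Pi.sub_apply]
    abel
  ext c
  constructor
  · rintro ⟨t, ht, s, hs, hts, rfl⟩
    exact ⟨t, ht, s, hs, hts, by rw [this]⟩
  · rintro ⟨t, ht, s, hs, hts, rfl⟩
    exact ⟨t, ht, s, hs, hts, by rw [this]⟩

theorem hol_tri {r α : ℝ} {x y : ℝ → Vec n} (hx : MemHol r α x) (hy : MemHol r α y) :
    holderNorm r α x ≤ holderNorm r α y + holderNorm r α (x - y) := by
  have hxy : MemHol r α (x - y) := ⟨hx.1.sub hy.1, (hol_sub_bound hx hy).1⟩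
  apply max_le
  · refine (supN_sub_le hx.1 hy.1).trans (add_le_add (le_max_left _ _) (le_max_left _ _))
  · refine le_trans ?_ (add_le_add (le_max_right _ _) (le_max_right _ _))
    refine (hol_of_bound (add_nonneg (hol_semi_nonneg _ _ _) (hol_semi_nonneg _ _ _)) ?_).2
    intro t ht s hs
    have h1 := hol_ratio hy ht hs
    have h2 := hol_ratio hxy ht hs
    have h3 : x t - x s = (y t - y s) + ((x - y) t - (x - y) s) := by
      simp only [Pi.sub_apply]
      abel
    rw [h3, add_mul]
    exact (norm_add_le _ _).trans (add_le_add h1 h2)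

theorem goodX_hol {r α : ℝ} (hr : 0 < r) (hα0 : 0 ≤ α) (hα1 : α ≤ 1) :
    GoodX n r α (MemHol r α) (holderNorm r α) where
  sub x y hx hy := ⟨hx.1.sub hy.1, (hol_sub_bound hx hy).1⟩
  zero_mem := ⟨continuousOn_const, (hol_of_bound (K := 0) le_rfl (by simp)).1⟩
  zero_norm := by
    apply le_antisymm
    · apply max_le
      · exact supN_le le_rfl (by simp)
      · exact (hol_of_bound (K := 0) le_rfl (by simp)).2
    · exact (supN_nonneg _ _).trans (le_max_left _ _)
  congr_mem x y e hx := ⟨hx.1.congr e.symm, by rw [← hRatios_congr e]; exact hx.2⟩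
  congr_norm x y e hx := by
    unfold holderNorm
    rw [supN_congr e, hRatios_congr e]
  nonneg x := (supN_nonneg _ _).trans (le_max_left _ _)
  tri x y hx hy := by
    have h1 := hol_tri hx hy
    have h2 := hol_tri hy hx
    have h3 : holderNorm r α (y - x) = holderNorm r α (x - y) := by
      unfold holderNorm
      rw [supN_sub_comm, hRatios_sub_comm]
    rw [abs_le]
    constructor <;> linarith
  hol x hx := hx
  sup_le x hx := le_max_left _ _
  concat := by
    have hrp : 0 ≤ r ^ (1 - α) := by positivity
    refine ⟨1 + r ^ (1 - α), by positivity, ?_⟩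
    intro z h T A B hT hA hB hz hzc hhc he hzA hhB t ht
    set S := sSup (hRatios α (Icc (-r) 0) z) with hS
    have hS0 : 0 ≤ S := hol_semi_nonneg _ _ _
    have hSN : S ≤ holderNorm r α z := le_max_right _ _
    have hlip : ∀ u v : ℝ, 0 ≤ u → u ≤ v → v ≤ T → ‖z v - z u‖ ≤ B * (v - u) := by
      intro u v hu huv hv
      have hi : ∀ a b : ℝ, 0 ≤ a → a ≤ b → b ≤ T → IntervalIntegrable h volume a b :=
        fun a b ha hab hb => (hhc.mono (Icc_subset_Icc ha hb)).intervalIntegrable_of_Icc hab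
      rw [he v ⟨hu.trans huv, hv⟩, he u ⟨hu, huv.trans hv⟩, add_sub_add_left_eq_sub,
        intervalIntegral.integral_interval_sub_left (hi _ _ le_rfl (hu.trans huv) hv)
          (hi _ _ le_rfl hu (huv.trans hv))]
      have := intervalIntegral.norm_integral_le_of_norm_le_const (a := u) (b := v) (f := h) (C := B)
        (by
          intro s hs
          rw [uIoc_of_le huv] at hs
          exact hhB s ⟨hu.trans hs.1.le, hs.2.trans hv⟩)
      rwa [abs_of_nonneg (by linarith)] at this
    have hpw : ∀ d : ℝ, 0 ≤ d → d ≤ r → d ≤ r ^ (1 - α) * d ^ α := by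
      intro d hd hdr
      rcases hd.eq_or_lt with h0 | h0
      · rw [← h0]
        positivity
      · calc d = d ^ (1 - α) * d ^ α := by
              rw [← Real.rpow_add h0]
              simp
          _ ≤ _ := by
            apply mul_le_mul_of_nonneg_right _ (by positivity)
            exact Real.rpow_le_rpow hd hdr (by linarith)
    have key : ∀ u v : ℝ, -r ≤ u → u ≤ v → v ≤ T → v - u ≤ r →
        ‖z v - z u‖ ≤ (S + r ^ (1 - α) * B) * (v - u) ^ α := by
      intro u v hu huv hv hd
      have hda : 0 ≤ (v - u) ^ α := Real.rpow_nonneg (by linarith) _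
      rw [add_mul]
      rcases le_total v 0 with hv0 | hv0
      · have := hol_ratio hz (t := v) (s := u) ⟨by linarith, hv0⟩ ⟨hu, by linarith⟩
        rw [abs_of_nonneg (by linarith)] at this
        have h2 : 0 ≤ r ^ (1 - α) * B * (v - u) ^ α := by positivity
        linarith
      · rcases le_total 0 u with hu0 | hu0
        · have h1 := hlip u v hu0 huv hv
          have h2 := mul_le_mul_of_nonneg_left (hpw (v - u) (by linarith) hd) hB
          have h3 : 0 ≤ S * (v - u) ^ α := by positivity
          nlinarith
        · have h1 := hlip 0 v le_rfl hv0 hv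
          have h2 := hol_ratio hz (t := 0) (s := u) ⟨by linarith, le_rfl⟩ ⟨hu, hu0⟩
          rw [abs_of_nonneg (by linarith)] at h2
          have h3 : (0 - u) ^ α ≤ (v - u) ^ α :=
            Real.rpow_le_rpow (by linarith) (by linarith) hα0
          have h4 := mul_le_mul_of_nonneg_left h3 hS0
          have h5 := mul_le_mul_of_nonneg_left (hpw (v - u) (by linarith) hd) hB
          have h6 : B * (v - 0) ≤ B * (v - u) := mul_le_mul_of_nonneg_left (by linarith) hB
          have h7 : z v - z u = (z v - z 0) + (z 0 - z u) := by abel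
          rw [h7]
          refine (norm_add_le _ _).trans ?_
          nlinarith
    have hb := hol_of_bound (r := r) (α := α) (K := S + r ^ (1 - α) * B) (by positivity)
      (g := seg r z t) (by
        intro a ha b hb
        have := ht.1
        have := ht.2
        have := ha.1
        have := ha.2
        have := hb.1
        have := hb.2
        rcases le_total b a with hab | hab
        · rw [abs_of_nonneg (by linarith)]
          have := key (t + b) (t + a) (by linarith) (by linarith) (by linarith) (by linarith)
          rw [add_sub_add_left_eq_sub] at this
          exact this
        · rw [abs_sub_comm, abs_of_nonneg (by linarith), norm_sub_rev]
          have := key (t + a) (t + b) (by linarith) (by linarith) (by linarith) (by linarith)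
          rw [add_sub_add_left_eq_sub] at this
          exact this)
    refine ⟨⟨seg_memC0 hzc ht, hb.1⟩, ?_⟩
    have hN0 : 0 ≤ holderNorm r α z := hS0.trans hSN
    have hsum : 0 ≤ holderNorm r α z + A + B := by positivity
    apply max_le
    · apply supN_le (by positivity)
      intro s hs
      refine (hzA (t + s) ⟨by linarith [ht.1, hs.1], by linarith [ht.2, hs.2]⟩).trans ?_
      nlinarith
    · refine hb.2.trans ?_
      nlinarith [mul_nonneg hrp hN0, mul_nonneg hrp hA]

/-! ### The Sobolev space -/

/-- `d` is a witness that `g` is in `W^{1,p}`. -/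
def WitW (r : ℝ) (p : ℝ≥0∞) (g d : ℝ → Vec n) : Prop :=
  IntegrableOn d (Icc (-r) 0) ∧
    eLpNorm d p (volume.restrict (Ioo (-r) 0)) < ⊤ ∧
    ∀ t ∈ Icc (-r) 0, g t = g (-r) + ∫ s in (-r)..t, d s

theorem WitW.deriv_ae {r : ℝ} {p : ℝ≥0∞} {g d : ℝ → Vec n} (hr : 0 < r) (h : WitW r p g d) :
    deriv g =ᵐ[volume.restrict (Ioo (-r) 0)] d := by
  have hi : IntervalIntegrable d volume (-r) 0 :=
    (intervalIntegrable_iff_integrableOn_Icc_of_le (by linarith)).2 h.1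
  have := hi.ae_hasDerivAt_integral
  rw [uIcc_of_le (by linarith)] at this
  rw [Filter.EventuallyEq, ae_restrict_iff' measurableSet_Ioo]
  filter_upwards [this] with t ht htI
  have h1 := ht (Ioo_subset_Icc_self htI) (-r) ⟨le_rfl, by linarith⟩
  have h2 := h1.const_add (g (-r))
  have h3 : g =ᶠ[𝓝 t] fun x => g (-r) + ∫ s in (-r)..x, d s := by
    filter_upwards [Ioo_mem_nhds htI.1 htI.2] with u hu
    exact h.2.2 u (Ioo_subset_Icc_self hu)
  exact (h2.congr_of_eventuallyEq h3).deriv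

theorem WitW.norm {r : ℝ} {p : ℝ≥0∞} {g d : ℝ → Vec n} (hr : 0 < r) (h : WitW r p g d) :
    sobNorm r p g = supN r g + (eLpNorm d p (volume.restrict (Ioo (-r) 0))).toReal := by
  unfold sobNorm
  rw [eLpNorm_congr_ae (h.deriv_ae hr)]

theorem WitW.meas {r : ℝ} {p : ℝ≥0∞} {g d : ℝ → Vec n} (h : WitW r p g d) :
    AEStronglyMeasurable d (volume.restrict (Ioo (-r) 0)) :=
  (h.1.mono_set Ioo_subset_Icc_self).aestronglyMeasurable

theorem WitW.interval {r : ℝ} {p : ℝ≥0∞} {g d : ℝ → Vec n} (h : WitW r p g d) {a b : ℝ}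
    (ha : a ∈ Icc (-r) 0) (hb : b ∈ Icc (-r) 0) : IntervalIntegrable d volume a b := by
  apply IntegrableOn.intervalIntegrable
  exact h.1.mono_set (uIcc_subset_Icc ha hb)

theorem WitW.memC0 {r : ℝ} {p : ℝ≥0∞} {g d : ℝ → Vec n} (hr : 0 < r) (h : WitW r p g d) :
    MemC0 r g := by
  have h1 : ContinuousOn (fun t => ∫ s in (-r)..t, d s) (Icc (-r) 0) := by
    have := intervalIntegral.continuousOn_primitive_interval (μ := volume) (f := d) (a := -r)
      (b := 0) (by rw [uIcc_of_le (by linarith)]; exact h.1)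
    rwa [uIcc_of_le (by linarith)] at this
  exact (continuousOn_const.add h1).congr (fun t ht => h.2.2 t ht)

theorem WitW.sub {r : ℝ} {p : ℝ≥0∞} (hp : 1 ≤ p) {g d g' d' : ℝ → Vec n}
    (h : WitW r p g d) (h' : WitW r p g' d') : WitW r p (g - g') (d - d') := by
  refine ⟨h.1.sub h'.1, ?_, ?_⟩
  · refine lt_of_le_of_lt (eLpNorm_sub_le h.meas h'.meas hp) ?_
    exact ENNReal.add_lt_top.2 ⟨h.2.1, h'.2.1⟩
  · intro t ht
    have hl : -r ∈ Icc (-r) 0 := ⟨le_rfl, ht.1.trans ht.2⟩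
    have e : ∫ s in (-r)..t, (d - d') s = (∫ s in (-r)..t, d s) - ∫ s in (-r)..t, d' s :=
      intervalIntegral.integral_sub (h.interval hl ht) (h'.interval hl ht)
    rw [e, Pi.sub_apply, Pi.sub_apply, h.2.2 t ht, h'.2.2 t ht]
    abel

theorem WitW.tri {r : ℝ} {p : ℝ≥0∞} (hr : 0 < r) (hp : 1 ≤ p) {g d g' d' : ℝ → Vec n}
    (h : WitW r p g d) (h' : WitW r p g' d') :
    sobNorm r p g ≤ sobNorm r p g' + sobNorm r p (g - g') := by
  have hs := h.sub hp h'
  rw [h.norm hr, h'.norm hr, hs.norm hr]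
  have h1 := supN_sub_le (h.memC0 hr) (h'.memC0 hr)
  have h2 : eLpNorm d p (volume.restrict (Ioo (-r) 0)) ≤
      eLpNorm d' p (volume.restrict (Ioo (-r) 0)) +
      eLpNorm (d - d') p (volume.restrict (Ioo (-r) 0)) := by
    have := eLpNorm_add_le h'.meas hs.meas hp
    rwa [add_sub_cancel] at this
  have h3 := ENNReal.toReal_mono (ENNReal.add_lt_top.2 ⟨h'.2.1, hs.2.1⟩).ne h2
  rw [ENNReal.toReal_add h'.2.1.ne hs.2.1.ne] at h3
  linarith

theorem WitW.hol {r : ℝ} {p : ℝ≥0∞} (hr : 0 < r) (hp : 1 ≤ p) {g d : ℝ → Vec n}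
    (h : WitW r p g d) : MemHol r (hexp p) g := by
  refine ⟨h.memC0 hr, ?_⟩
  set D := (eLpNorm d p (volume.restrict (Ioo (-r) 0))).toReal with hD
  refine (hol_of_bound (K := D) ENNReal.toReal_nonneg ?_).1
  have key : ∀ s t : ℝ, -r ≤ s → s ≤ t → t ≤ 0 → ‖g t - g s‖ ≤ D * (t - s) ^ hexp p := by
    intro s t hs hst ht
    have hsI : s ∈ Icc (-r) 0 := ⟨hs, hst.trans ht⟩
    have htI : t ∈ Icc (-r) 0 := ⟨hs.trans hst, ht⟩
    have hl : -r ∈ Icc (-r) 0 := ⟨le_rfl, by linarith⟩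
    rw [h.2.2 t htI, h.2.2 s hsI, add_sub_add_left_eq_sub,
      intervalIntegral.integral_interval_sub_left (h.interval hl htI) (h.interval hl hsI),
      intervalIntegral.integral_of_le hst, ← restrict_Ioo_eq_restrict_Ioc]
    have hsub : Ioo s t ⊆ Ioo (-r) 0 := Ioo_subset_Ioo hs ht
    have hmeas : AEStronglyMeasurable d (volume.restrict (Ioo s t)) :=
      h.meas.mono_measure (Measure.restrict_mono hsub le_rfl)
    have h1 : ENNReal.ofReal ‖∫ u in Ioo s t, d u‖ ≤ eLpNorm d 1 (volume.restrict (Ioo s t)) := by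
      rw [ofReal_norm, eLpNorm_one_eq_lintegral_enorm]
      exact enorm_integral_le_lintegral_enorm _
    have h2 := eLpNorm_le_eLpNorm_mul_rpow_measure_univ hp hmeas
    have h3 : eLpNorm d p (volume.restrict (Ioo s t)) ≤
        eLpNorm d p (volume.restrict (Ioo (-r) 0)) :=
      eLpNorm_mono_measure _ (Measure.restrict_mono hsub le_rfl)
    have h4 : ENNReal.ofReal ‖∫ u in Ioo s t, d u‖ ≤ ENNReal.ofReal (D * (t - s) ^ hexp p) := by
      refine h1.trans (h2.trans ?_)
      rw [ENNReal.ofReal_mul ENNReal.toReal_nonneg, ENNReal.ofReal_toReal h.2.1.ne]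
      refine mul_le_mul' h3 (le_of_eq ?_)
      have h0 : 0 ≤ hexp p := by
        unfold hexp
        rcases eq_or_ne p ⊤ with rfl | hpt
        · simp
        · have : 1 ≤ p.toReal := by
            simpa using ENNReal.toReal_mono hpt hp
          have := inv_le_one_of_one_le₀ this
          linarith
      rw [← ENNReal.ofReal_rpow_of_nonneg (by linarith) h0]
      simp [hexp]
    exact (ENNReal.ofReal_le_ofReal_iff
      (mul_nonneg ENNReal.toReal_nonneg (Real.rpow_nonneg (by linarith) _))).1 h4
  intro t ht s hs
  rcases le_total s t with hst | hst
  · rw [abs_of_nonneg (by linarith)]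
    exact key s t hs.1 hst ht.2
  · rw [abs_sub_comm, abs_of_nonneg (by linarith), norm_sub_rev]
    exact key t s ht.1 hst hs.2

theorem WitW.concat {r : ℝ} {p : ℝ≥0∞} (hr : 0 < r) (hp : 1 ≤ p) {z d0 h : ℝ → Vec n}
    (hz : WitW r p z d0) {T B : ℝ} (hT : 0 ≤ T) (hB : 0 ≤ B)
    (hhc : ContinuousOn h (Icc 0 T))
    (he : ∀ t ∈ Icc 0 T, z t = z 0 + ∫ s in (0:ℝ)..t, h s)
    (hhB : ∀ t ∈ Icc 0 T, ‖h t‖ ≤ B) {t : ℝ} (ht : t ∈ Icc 0 T) :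
    ∃ d : ℝ → Vec n, WitW r p (seg r z t) d ∧
      (eLpNorm d p (volume.restrict (Ioo (-r) 0))).toReal ≤
        (eLpNorm d0 p (volume.restrict (Ioo (-r) 0))).toReal + r ^ p.toReal⁻¹ * B := by
  set P := (Ioc (-r) 0).indicator d0 with hP
  set Q := (Ioc 0 T).indicator h with hQ
  have hPi : Integrable P := by
    rw [hP, integrable_indicator_iff measurableSet_Ioc]
    exact hz.1.mono_set Ioc_subset_Icc_self
  have hQi : Integrable Q := by
    rw [hQ, integrable_indicator_iff measurableSet_Ioc]
    exact hhc.integrableOn_Icc.mono_set Ioc_subset_Icc_self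
  have hD : Integrable (P + Q) := hPi.add hQi
  have hii : ∀ a b : ℝ, IntervalIntegrable (P + Q) volume a b := fun a b => hD.intervalIntegrable
  have e1 : ∀ τ ∈ Icc (-r) 0, ∫ s in (-r)..τ, (P + Q) s = ∫ s in (-r)..τ, d0 s := by
    intro τ hτ
    apply intervalIntegral.integral_congr_ae
    refine Eventually.of_forall fun s hs => ?_
    rw [uIoc_of_le hτ.1] at hs
    have h1 : s ∈ Ioc (-r) 0 := ⟨hs.1, hs.2.trans hτ.2⟩
    have h2 : s ∉ Ioc 0 T := fun h => absurd h.1 (not_lt.2 h1.2)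
    simp [hP, hQ, indicator_of_mem h1, indicator_of_notMem h2]
  have e2 : ∀ τ ∈ Icc 0 T, ∫ s in (0:ℝ)..τ, (P + Q) s = ∫ s in (0:ℝ)..τ, h s := by
    intro τ hτ
    apply intervalIntegral.integral_congr_ae
    refine Eventually.of_forall fun s hs => ?_
    rw [uIoc_of_le hτ.1] at hs
    have h1 : s ∈ Ioc 0 T := ⟨hs.1, hs.2.trans hτ.2⟩
    have h2 : s ∉ Ioc (-r) 0 := fun h => absurd h.2 (not_le.2 h1.1)
    simp [hP, hQ, indicator_of_mem h1, indicator_of_notMem h2]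
  have hrep : ∀ τ ∈ Icc (-r) T, z τ = z (-r) + ∫ s in (-r)..τ, (P + Q) s := by
    intro τ hτ
    rcases le_total τ 0 with h0 | h0
    · rw [e1 τ ⟨hτ.1, h0⟩]
      exact hz.2.2 τ ⟨hτ.1, h0⟩
    · rw [← intervalIntegral.integral_add_adjacent_intervals (hii (-r) 0) (hii 0 τ),
        e1 0 ⟨by linarith, le_rfl⟩, e2 τ ⟨h0, hτ.2⟩, ← add_assoc,
        ← hz.2.2 0 ⟨by linarith, le_rfl⟩]
      exact he τ ⟨h0, hτ.2⟩
  have hmp : MeasurePreserving (fun u : ℝ => t + u) volume volume := measurePreserving_add_left _ t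
  have hPm := hPi.aestronglyMeasurable
  have hQm := hQi.aestronglyMeasurable
  have hPc : AEStronglyMeasurable (P ∘ fun u => t + u) (volume.restrict (Ioo (-r) 0)) :=
    (hPm.comp_measurePreserving hmp).restrict
  have hQc : AEStronglyMeasurable (Q ∘ fun u => t + u) (volume.restrict (Ioo (-r) 0)) :=
    (hQm.comp_measurePreserving hmp).restrict
  have b1 : eLpNorm (P ∘ fun u => t + u) p (volume.restrict (Ioo (-r) 0)) ≤
      eLpNorm d0 p (volume.restrict (Ioo (-r) 0)) := by
    refine (eLpNorm_mono_measure _ Measure.restrict_le_self).trans ?_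
    rw [eLpNorm_comp_measurePreserving hPm hmp, hP,
      eLpNorm_indicator_eq_eLpNorm_restrict measurableSet_Ioc, restrict_Ioo_eq_restrict_Ioc]
  have b2 : eLpNorm (Q ∘ fun u => t + u) p (volume.restrict (Ioo (-r) 0)) ≤
      ENNReal.ofReal (r ^ p.toReal⁻¹ * B) := by
    have h1 := eLpNorm_le_of_ae_bound (p := p) (μ := volume.restrict (Ioo (-r) 0))
      (f := Q ∘ fun u => t + u) (C := B) (Eventually.of_forall fun u => by
        simp only [Function.comp, hQ]
        by_cases hu : t + u ∈ Ioc 0 T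
        · rw [indicator_of_mem hu]
          exact hhB _ (Ioc_subset_Icc_self hu)
        · rw [indicator_of_notMem hu, norm_zero]
          exact hB)
    refine h1.trans (le_of_eq ?_)
    rw [ENNReal.ofReal_mul (by positivity),
      ← ENNReal.ofReal_rpow_of_nonneg hr.le (by positivity)]
    simp
  have b3 : eLpNorm (fun u => (P + Q) (t + u)) p (volume.restrict (Ioo (-r) 0)) ≤
      eLpNorm d0 p (volume.restrict (Ioo (-r) 0)) + ENNReal.ofReal (r ^ p.toReal⁻¹ * B) :=
    (eLpNorm_add_le hPc hQc hp).trans (add_le_add b1 b2)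
  have b4 : eLpNorm d0 p (volume.restrict (Ioo (-r) 0)) + ENNReal.ofReal (r ^ p.toReal⁻¹ * B) < ⊤ :=
    ENNReal.add_lt_top.2 ⟨hz.2.1, ENNReal.ofReal_lt_top⟩
  refine ⟨fun u => (P + Q) (t + u), ⟨?_, b3.trans_lt b4, ?_⟩, ?_⟩
  · exact (hmp.integrable_comp_of_integrable hD).integrableOn
  · intro s hs
    rw [intervalIntegral.integral_comp_add_left (fun u => (P + Q) u)]
    simp only [seg]
    rw [hrep (t + s) ⟨by linarith [ht.1, hs.1], by linarith [ht.2, hs.2]⟩,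
      hrep (t + -r) ⟨by linarith [ht.1], by linarith [ht.2]⟩, add_assoc,
      intervalIntegral.integral_add_adjacent_intervals (hii _ _) (hii _ _)]
  · have := ENNReal.toReal_mono b4.ne b3
    rwa [ENNReal.toReal_add hz.2.1.ne ENNReal.ofReal_ne_top,
      ENNReal.toReal_ofReal (by positivity)] at this

theorem goodX_sob {r : ℝ} (hr : 0 < r) {p : ℝ≥0∞} (hp : 1 ≤ p) :
    GoodX n r (hexp p) (MemW r p) (sobNorm r p) where
  sub x y := by
    rintro ⟨d, hd⟩ ⟨d', hd'⟩
    exact ⟨d - d', WitW.sub hp hd hd'⟩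
  zero_mem := ⟨0, by simp [IntegrableOn], by simp, by simp⟩
  zero_norm := by
    have h : WitW r p (0 : ℝ → Vec n) 0 := ⟨by simp [IntegrableOn], by simp, by simp⟩
    rw [h.norm hr]
    have : supN r (0 : ℝ → Vec n) = 0 :=
      le_antisymm (supN_le le_rfl (by simp)) (supN_nonneg _ _)
    simp [this]
  congr_mem x y e := by
    rintro ⟨d, h1, h2, h3⟩
    refine ⟨d, h1, h2, fun t ht => ?_⟩
    rw [← e ht, ← e ⟨le_rfl, by linarith⟩]
    exact h3 t ht
  congr_norm x y e := by
    rintro ⟨d, h1, h2, h3⟩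
    have hx : WitW r p x d := ⟨h1, h2, h3⟩
    have hy : WitW r p y d := ⟨h1, h2, fun t ht => by
      rw [← e ht, ← e ⟨le_rfl, by linarith⟩]
      exact h3 t ht⟩
    rw [hx.norm hr, hy.norm hr, supN_congr e]
  nonneg x := add_nonneg (supN_nonneg _ _) ENNReal.toReal_nonneg
  tri x y := by
    rintro ⟨d, hd⟩ ⟨d', hd'⟩
    have h1 := WitW.tri hr hp hd hd'
    have h2 := WitW.tri hr hp hd' hd
    have h3 : sobNorm r p (y - x) = sobNorm r p (x - y) := by
      rw [(WitW.sub hp hd hd').norm hr, (WitW.sub hp hd' hd).norm hr, supN_sub_comm,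
        eLpNorm_sub_comm]
    rw [abs_le]
    constructor <;> linarith
  hol x := by
    rintro ⟨d, hd⟩
    exact WitW.hol hr hp hd
  sup_le x _ := le_add_of_nonneg_right ENNReal.toReal_nonneg
  concat := by
    have hrp : 0 ≤ r ^ p.toReal⁻¹ := by positivity
    refine ⟨1 + r ^ p.toReal⁻¹, by positivity, ?_⟩
    rintro z h T A B hT hA hB ⟨d0, hd0⟩ hzc hhc he hzA hhB t ht
    have hz : WitW r p z d0 := hd0
    obtain ⟨d, hd, hdn⟩ := hz.concat hr hp hT hB hhc he hhB ht
    refine ⟨⟨d, hd⟩, ?_⟩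
    rw [hd.norm hr, hz.norm hr]
    have h1 : supN r (seg r z t) ≤ A := by
      apply supN_le hA
      intro s hs
      exact hzA (t + s) ⟨by linarith [ht.1, hs.1], by linarith [ht.2, hs.2]⟩
    have h2 := supN_nonneg r z
    have h3 : 0 ≤ (eLpNorm d0 p (volume.restrict (Ioo (-r) 0))).toReal := ENNReal.toReal_nonneg
    nlinarith [mul_nonneg hrp h2, mul_nonneg hrp h3, mul_nonneg hrp hA, mul_nonneg hrp hB]

/-- Coercive Lyapunov–Krasovskii characterization of UGAS in
`X = W^{1,p}` or `X = C^{0,1-1/p}` (`p ∈ (1,∞]`), for a system forward complete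
from Hölder `C^{0,1-1/p}` initial data: UGAS-X holds iff there is a functional
`V : X → [0,∞)`, Lipschitz on bounded subsets of `X`, sandwiched between two
`K∞` functions of the `X`-norm and decaying as `exp(-t)` along solutions. -/
theorem stmt8 (n : ℕ) (hn : 1 ≤ n) (r : ℝ) (hr : 0 < r)
    (f : (ℝ → Vec n) → Vec n) (L : ℝ → ℝ) (hf : GoodRHS r f L)
    (p : ℝ≥0∞) (hp : 1 < p)
    (hFC : ∀ x0 : ℝ → Vec n, MemHol r (hexp p) x0 → ∃ x : ℝ → Vec n, IsSol r f x0 x ⊤)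
    (MemX : (ℝ → Vec n) → Prop) (NormX : (ℝ → Vec n) → ℝ)
    (hX : (MemX = MemW r p ∧ NormX = sobNorm r p) ∨
          (MemX = MemHol r (hexp p) ∧ NormX = holderNorm r (hexp p))) :
    (∃ σ : ℝ → ℝ → ℝ, ClassKL σ ∧ ∀ x0 x : ℝ → Vec n, MemX x0 →
        IsSol r f x0 x ⊤ → ∀ t : ℝ, 0 ≤ t → NormX (seg r x t) ≤ σ (NormX x0) t)
    ↔
    (∃ V : (ℝ → Vec n) → ℝ, ∃ a1 a2 : ℝ → ℝ,
      (∀ x : ℝ → Vec n, MemX x → 0 ≤ V x) ∧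
      (∀ R : ℝ, 0 < R → ∃ K : ℝ, ∀ x y : ℝ → Vec n, MemX x → MemX y →
        NormX x ≤ R → NormX y ≤ R → |V x - V y| ≤ K * NormX (x - y)) ∧
      ClassKInf a1 ∧ ClassKInf a2 ∧
      (∀ x : ℝ → Vec n, MemX x → a1 (NormX x) ≤ V x ∧ V x ≤ a2 (NormX x)) ∧
      (∀ x0 x : ℝ → Vec n, MemX x0 → IsSol r f x0 x ⊤ →
        ∀ t : ℝ, 0 ≤ t → V (seg r x t) ≤ Real.exp (-t) * V x0)) := by
  have hα : 0 ≤ hexp p ∧ hexp p ≤ 1 := by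
    unfold hexp
    constructor
    · rcases eq_or_ne p ⊤ with rfl | hpt
      · simp
      · have : 1 ≤ p.toReal := by
          simpa using ENNReal.toReal_mono hpt hp.le
        have := inv_le_one_of_one_le₀ this
        linarith
    · have : 0 ≤ (p.toReal)⁻¹ := inv_nonneg.2 ENNReal.toReal_nonneg
      linarith
  have hG : GoodX n r (hexp p) MemX NormX := by
    rcases hX with ⟨rfl, rfl⟩ | ⟨rfl, rfl⟩
    · exact goodX_sob hr hp.le
    · exact goodX_hol hr hα.1 hα.2
  constructor
  · rintro ⟨σ, hσ, hKL⟩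
    exact hG.converse hr hf hFC σ hσ hKL
  · rintro ⟨V, a1, a2, _, _, ha1, ha2, hV, hd⟩
    exact hG.direct hf V a1 a2 ha1 ha2 hV hd
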